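/- Suppose μ−η and λ−η lie in the lowest p-alcove C₀, μ−λ ∈ ℤR, s, w ∈ W, and there exist u ∈ W and ν ∈ X such that w = u s π(u)⁻¹ and λ = u(μ) + pν − w(π(ν)). Suppose moreover ν = Σ_{i∈S} α_i is a multiplicity-free sum of roots α_i whose coroots α_i∨ are highest coroots. Then w(π(ν)) = ν and u = Π_{i∈S} s_{α_i}. -/

import Mathlib

open scoped Classical Pointwise

namespace SerrePaper

variable (V : Type) [AddCommGroup V] [Module ℝ V]

/-- The combinatorial context of the paper: the character lattice `X` of a split maximal
torus, sitting inside the real vector space `V = X ⊗ ℝ`, together with a reduced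
crystallographic root system `R` with positive roots `Rpos`, simple roots `Δ`,
the coroot pairing `coroot α = ⟨·, α∨⟩`, the weight `η` pairing to `1` with every simple
coroot, and the longest element `w0` of the Weyl group. -/
structure Ctx where
  R : Finset V
  Rpos : Finset V
  Δ : Finset V
  coroot : V → V →ₗ[ℝ] ℝ
  eta : V
  w0 : V ≃ₗ[ℝ] V
  X : AddSubgroup V
  pos_subset : Rpos ⊆ R
  simple_subset : Δ ⊆ Rpos
  root_ne_zero : ∀ α ∈ R, α ≠ (0 : V)
  neg_mem : ∀ α ∈ R, -α ∈ R
  pos_or_neg : ∀ α ∈ R, α ∈ Rpos ∨ -α ∈ Rpos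
  pos_not_neg : ∀ α ∈ Rpos, -α ∉ Rpos
  coroot_self : ∀ α ∈ R, coroot α α = 2
  coroot_neg : ∀ α ∈ R, coroot (-α) = -coroot α
  crystallographic : ∀ α ∈ R, ∀ β ∈ R, ∃ n : ℤ, coroot α β = (n : ℝ)
  reduced : ∀ α ∈ R, ∀ c : ℝ, c • α ∈ R → c = 1 ∨ c = -1
  reflect_root : ∀ α ∈ R, ∀ β ∈ R, β - coroot α β • α ∈ R
  reflect_coroot : ∀ α ∈ R, ∀ β ∈ R, ∀ x : V,
    coroot (β - coroot α β • α) x = coroot β x - coroot β α * coroot α x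
  pos_sum_simple : ∀ α ∈ Rpos, ∃ c : V → ℕ, α = ∑ β ∈ Δ, (c β : ℝ) • β
  simple_indep : LinearIndependent ℝ (fun β : {x // x ∈ Δ} => (β : V))
  eta_pair : ∀ α ∈ Δ, coroot α eta = 1
  root_mem_X : ∀ α ∈ R, α ∈ X
  eta_mem_X : eta ∈ X
  coroot_int : ∀ α ∈ R, ∀ x ∈ X, ∃ n : ℤ, coroot α x = (n : ℝ)
  w0_mem : w0 ∈ Subgroup.closure {g : V ≃ₗ[ℝ] V | ∃ α ∈ R, ∀ x, g x = x - coroot α x • α}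
  w0_neg : ∀ α ∈ Rpos, -(w0 α) ∈ Rpos

namespace Ctx

variable {V}
variable (S : Ctx V)

/-- The (finite) Weyl group, generated by the reflections `s_α`, `α ∈ R`. -/
def Weyl : Subgroup (V ≃ₗ[ℝ] V) :=
  Subgroup.closure {g : V ≃ₗ[ℝ] V | ∃ α ∈ S.R, ∀ x, g x = x - S.coroot α x • α}

/-- The translation `t_ν` as an affine automorphism of `V`. -/
def trans (_S : Ctx V) (ν : V) : V ≃ᵃ[ℝ] V := AffineEquiv.constVAdd ℝ V ν

/-- A linear automorphism viewed as an affine automorphism. -/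
def ofW (_S : Ctx V) (w : V ≃ₗ[ℝ] V) : V ≃ᵃ[ℝ] V := w.toAffineEquiv

/-- The extended affine Weyl group `W̃ = X ⋊ W`, realized as the set of affine
transformations of the form `t_ν ∘ w` with `ν ∈ X` and `w ∈ W`. -/
def extAff : Set (V ≃ᵃ[ℝ] V) :=
  {g | ∃ ν ∈ S.X, ∃ w ∈ S.Weyl, g = S.trans ν * S.ofW w}

/-- The base alcove `A₀`. -/
def A0 : Set V := {x | ∀ α ∈ S.Rpos, 0 < S.coroot α x ∧ S.coroot α x < 1}

/-- The affine hyperplane `⟨·,α∨⟩ = n` separates the base alcove `A₀` from its image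
`g(A₀)`. -/
def Separates (α : V) (n : ℤ) (g : V ≃ᵃ[ℝ] V) : Prop :=
  ((∀ x ∈ S.A0, S.coroot α x < (n : ℝ)) ∧ (∀ x ∈ S.A0, (n : ℝ) < S.coroot α (g x))) ∨
  ((∀ x ∈ S.A0, (n : ℝ) < S.coroot α x) ∧ (∀ x ∈ S.A0, S.coroot α (g x) < (n : ℝ)))

/-- The length `ℓ(g)` of an element of the extended affine Weyl group: the number of
affine root hyperplanes separating `A₀` from `g(A₀)`. -/
noncomputable def len (g : V ≃ᵃ[ℝ] V) : ℕ :=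
  Set.ncard {q : V × ℤ | q.1 ∈ S.Rpos ∧ S.Separates q.1 q.2 g}

/-- The set of affine reflections `s_{α,n} : x ↦ x - (⟨x,α∨⟩ - n)α`. -/
def affRefl : Set (V ≃ᵃ[ℝ] V) :=
  {g | ∃ α ∈ S.R, ∃ n : ℤ, ∀ x, g x = x - (S.coroot α x - (n : ℝ)) • α}

/-- The Bruhat order on the extended affine Weyl group, generated by
`u < r·u` for affine reflections `r` with `ℓ(u) < ℓ(r·u)` (this fixes the
`Ω`-component, so it is the componentwise extension of the Bruhat order on `W_a`). -/
def bruhatLE : (V ≃ᵃ[ℝ] V) → (V ≃ᵃ[ℝ] V) → Prop :=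
  Relation.ReflTransGen fun u w => (∃ r ∈ S.affRefl, w = r * u) ∧ S.len u < S.len w

/-- Jantzen's `↑`-order, transported to the (extended) affine Weyl group via
`w̃ ↦ w̃(A₀)`: generated by `u ↑ s_{α,n}·u` whenever `u(A₀)` lies below the hyperplane
`⟨·,α∨⟩ = n`.  (Under the affine rescaling `λ ↦ (λ+η)/p` this is equivalent to the usual
`↑`-order on `p`-alcoves, transported via the `p`-dot action `w̃ ↦ w̃ · C₀`.) -/
def upLE : (V ≃ᵃ[ℝ] V) → (V ≃ᵃ[ℝ] V) → Prop :=
  Relation.ReflTransGen fun u w =>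
    ∃ α ∈ S.Rpos, ∃ n : ℤ,
      (∀ x : V, w x = u x - (S.coroot α (u x) - (n : ℝ)) • α) ∧
      ∀ x ∈ S.A0, S.coroot α (u x) < (n : ℝ)

/-- `W̃⁺`: the elements of `W̃` taking the base alcove to a dominant alcove. -/
def Wplus : Set (V ≃ᵃ[ℝ] V) :=
  {g | g ∈ S.extAff ∧ ∀ x ∈ S.A0, ∀ α ∈ S.Δ, 0 < S.coroot α (g x)}

/-- `W̃₁`: the elements of `W̃` taking the base alcove to a restricted alcove. -/
def Wone : Set (V ≃ᵃ[ℝ] V) :=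
  {g | g ∈ S.extAff ∧ ∀ x ∈ S.A0, ∀ α ∈ S.Δ,
    0 < S.coroot α (g x) ∧ S.coroot α (g x) < 1}

/-- `w̃_h = w₀ t_{-η}`. -/
noncomputable def wh : V ≃ᵃ[ℝ] V := S.ofW S.w0 * S.trans (-S.eta)

/-- The lowest `p`-alcove `C₀`. -/
def C0 (p : ℕ) : Set V :=
  {x | ∀ α ∈ S.Rpos, 0 < S.coroot α (x + S.eta) ∧ S.coroot α (x + S.eta) < (p : ℝ)}

/-- The root lattice `ℤR`. -/
def rootLattice : AddSubgroup V := AddSubgroup.closure (S.R : Set V)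

/-- `Ω`: the stabilizer of the base alcove in `W̃`. -/
def Omega : Set (V ≃ᵃ[ℝ] V) := {g | g ∈ S.extAff ∧ g '' S.A0 = S.A0}

/-- The `λ`-admissible set `Adm(λ) = ⋃_{w ∈ W} W̃_{≤ t_{w(λ)}}`. -/
def Adm (lam : V) : Set (V ≃ᵃ[ℝ] V) :=
  {g | ∃ w ∈ S.Weyl, S.bruhatLE g (S.trans (w lam))}

/-- `α∨` is a highest coroot, i.e. the highest root of an irreducible component of the
dual root system `R∨`: equivalently, `α∨` is a dominant coroot and no simple coroot can
be added to `α∨` to yield a coroot. -/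
def IsHighestCoroot (α : V) : Prop :=
  α ∈ S.R ∧ (∀ β ∈ S.Δ, 0 ≤ S.coroot α β) ∧
    ∀ β ∈ S.Δ, ∀ γ ∈ S.R, S.coroot γ ≠ S.coroot α + S.coroot β

end Ctx


namespace Ctx

variable {V}
variable (S : Ctx V)

/-- The reflection `s_α` as a linear automorphism (the identity when `α` is not a root). -/
noncomputable def refl (α : V) : V ≃ₗ[ℝ] V :=
  if h : S.coroot α α = 2 then Module.reflection h else 1

/-- Linear automorphisms preserving the roots and their pairing with coroots. -/
def rootAut : Submonoid (V ≃ₗ[ℝ] V) where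
  carrier := {g | ∀ α ∈ S.R, g α ∈ S.R ∧ ∀ x, S.coroot (g α) (g x) = S.coroot α x}
  one_mem' := fun α hα => ⟨hα, fun _ => rfl⟩
  mul_mem' := by
    intro a b ha hb α hα
    refine ⟨(ha _ (hb α hα).1).1, fun x => ?_⟩
    change S.coroot (a (b α)) (a (b x)) = _
    rw [(ha _ (hb α hα).1).2, (hb α hα).2]

/-- The Weyl group element given by a word in the reflections. -/
noncomputable def word (L : List V) : V ≃ₗ[ℝ] V := (L.map S.refl).prod

/-- The Weyl-invariant symmetric bilinear form `∑ ⟨x, γ∨⟩⟨y, γ∨⟩`. -/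
def form (x y : V) : ℝ := ∑ γ ∈ S.R, S.coroot γ x * S.coroot γ y

variable {S}

lemma mem_R_of_pos {α : V} (h : α ∈ S.Rpos) : α ∈ S.R := S.pos_subset h

lemma pos_of_simple {α : V} (h : α ∈ S.Δ) : α ∈ S.Rpos := S.simple_subset h

lemma mem_R_of_simple {α : V} (h : α ∈ S.Δ) : α ∈ S.R := mem_R_of_pos (pos_of_simple h)

lemma refl_apply {α : V} (hα : α ∈ S.R) (x : V) :
    S.refl α x = x - S.coroot α x • α := by
  rw [refl, dif_pos (S.coroot_self α hα), Module.reflection_apply]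

lemma refl_mul_self {α : V} (hα : α ∈ S.R) : S.refl α * S.refl α = 1 := by
  ext x
  have h := S.coroot_self α hα
  simp only [LinearEquiv.mul_apply, refl_apply hα, map_sub, map_smul, h, smul_eq_mul,
    LinearEquiv.coe_one, id]
  module

lemma refl_inv {α : V} (hα : α ∈ S.R) : (S.refl α)⁻¹ = S.refl α :=
  inv_eq_of_mul_eq_one_left (refl_mul_self hα)

lemma refl_self {α : V} (hα : α ∈ S.R) : S.refl α α = -α := by
  rw [refl_apply hα, S.coroot_self α hα]
  module

lemma refl_mem_R {α β : V} (hα : α ∈ S.R) (hβ : β ∈ S.R) : S.refl α β ∈ S.R := by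
  rw [refl_apply hα]
  exact S.reflect_root α hα β hβ

lemma coroot_refl {α β : V} (hα : α ∈ S.R) (hβ : β ∈ S.R) (x : V) :
    S.coroot (S.refl α β) x = S.coroot β x - S.coroot β α * S.coroot α x := by
  rw [refl_apply hα]
  exact S.reflect_coroot α hα β hβ x

lemma coroot_refl_eq {α β : V} (hα : α ∈ S.R) (hβ : β ∈ S.R) (x : V) :
    S.coroot (S.refl α β) x = S.coroot β (S.refl α x) := by
  rw [coroot_refl hα hβ, refl_apply hα, map_sub, map_smul, smul_eq_mul]
  ring

lemma refl_refl {α : V} (hα : α ∈ S.R) (x : V) : S.refl α (S.refl α x) = x := by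
  have := congrArg (fun g : V ≃ₗ[ℝ] V => g x) (refl_mul_self hα)
  simpa using this

lemma refl_mem_weyl {α : V} (hα : α ∈ S.R) : S.refl α ∈ S.Weyl :=
  Subgroup.subset_closure ⟨α, hα, refl_apply hα⟩

lemma eq_refl_of_apply {α : V} (hα : α ∈ S.R) {g : V ≃ₗ[ℝ] V}
    (hg : ∀ x, g x = x - S.coroot α x • α) : g = S.refl α := by
  ext x
  rw [hg, refl_apply hα]

lemma refl_mem_rootAut {α : V} (hα : α ∈ S.R) : S.refl α ∈ S.rootAut := by
  intro β hβ
  refine ⟨refl_mem_R hα hβ, fun x => ?_⟩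
  rw [coroot_refl_eq hα hβ, refl_refl hα]

lemma inv_mem_rootAut {g : V ≃ₗ[ℝ] V} (hg : g ∈ S.rootAut) : g⁻¹ ∈ S.rootAut := by
  intro α hα
  obtain ⟨β, hβ, rfl⟩ : ∃ β ∈ S.R, g β = α := by
    have := Finset.surj_on_of_inj_on_of_card_le (s := S.R) (t := S.R) (fun a _ => g a)
      (fun a ha => (hg a ha).1) (fun a b _ _ h => g.injective h) le_rfl α hα
    obtain ⟨β, hβ, h⟩ := this
    exact ⟨β, hβ, h.symm⟩
  have hinv : ∀ y, g⁻¹ (g y) = y := fun y => g.symm_apply_apply y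
  have hinv' : ∀ y, g (g⁻¹ y) = y := fun y => g.apply_symm_apply y
  refine ⟨by rwa [hinv], fun x => ?_⟩
  rw [hinv, ← (hg β hβ).2, hinv']

lemma weyl_le_rootAut {g : V ≃ₗ[ℝ] V} (hg : g ∈ S.Weyl) : g ∈ S.rootAut := by
  induction hg using Subgroup.closure_induction with
  | mem x hx =>
    obtain ⟨α, hα, h⟩ := hx
    rw [eq_refl_of_apply hα h]
    exact refl_mem_rootAut hα
  | one => exact one_mem _
  | mul x y _ _ hx hy => exact mul_mem hx hy
  | inv x _ hx => exact inv_mem_rootAut hx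

/-! ### The invariant form -/

lemma form_refl {α : V} (hα : α ∈ S.R) (x y : V) :
    S.form (S.refl α x) (S.refl α y) = S.form x y := by
  refine Finset.sum_nbij' (fun γ => S.refl α γ) (fun γ => S.refl α γ)
    (fun γ hγ => refl_mem_R hα hγ) (fun γ hγ => refl_mem_R hα hγ)
    (fun γ _ => refl_refl hα γ) (fun γ _ => refl_refl hα γ) (fun γ hγ => ?_)
  rw [coroot_refl_eq hα hγ, coroot_refl_eq hα hγ]

lemma form_comm (x y : V) : S.form x y = S.form y x :=
  Finset.sum_congr rfl fun _ _ => mul_comm _ _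

lemma form_sub_smul (x y z : V) (c : ℝ) : S.form (x - c • y) z = S.form x z - c * S.form y z := by
  simp only [form, Finset.mul_sum, ← Finset.sum_sub_distrib, map_sub, map_smul, smul_eq_mul]
  exact Finset.sum_congr rfl fun _ _ => by ring

lemma form_self_pos {α : V} (hα : α ∈ S.R) : 0 < S.form α α :=
  Finset.sum_pos' (fun _ _ => mul_self_nonneg _)
    ⟨α, hα, by rw [S.coroot_self α hα]; norm_num⟩

lemma two_mul_form {α : V} (hα : α ∈ S.R) (x : V) :
    2 * S.form x α = S.coroot α x * S.form α α := by
  have h := form_refl hα x α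
  rw [refl_self hα, refl_apply hα] at h
  have h2 : ∀ y, S.form y (-α) = - S.form y α := by
    intro y
    simp [form]
  rw [h2, form_sub_smul] at h
  linarith

lemma coroot_pos_symm {α β : V} (hα : α ∈ S.R) (hβ : β ∈ S.R) (h : 0 < S.coroot α β) :
    0 < S.coroot β α := by
  have h1 := two_mul_form hα β
  have h2 := two_mul_form hβ α
  have h3 := form_self_pos hα
  have h4 := form_self_pos hβ
  rw [form_comm] at h2
  have : 0 < S.coroot β α * S.form β β := by rw [← h2, h1]; positivity
  exact pos_of_mul_pos_left this h4.le

lemma coroot_nonneg_symm {α β : V} (hα : α ∈ S.R) (hβ : β ∈ S.R) (h : 0 ≤ S.coroot α β) :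
    0 ≤ S.coroot β α := by
  by_contra! hc
  have h1 : 0 < S.coroot (-β) α := by rw [S.coroot_neg β hβ]; simpa using hc
  have h2 := coroot_pos_symm (S.neg_mem β hβ) hα h1
  rw [map_neg] at h2
  linarith

lemma coroot_zero_symm {α β : V} (hα : α ∈ S.R) (hβ : β ∈ S.R) (h : S.coroot α β = 0) :
    S.coroot β α = 0 := by
  refine le_antisymm ?_ (coroot_nonneg_symm hα hβ h.ge)
  by_contra! hc
  exact (coroot_pos_symm hβ hα hc).ne' h

lemma eq_of_two_le_coroot {α β : V} (hα : α ∈ S.R) (hβ : β ∈ S.R)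
    (h1 : 2 ≤ S.coroot α β) (h2 : 2 ≤ S.coroot β α) : α = β := by
  have f1 := two_mul_form hα β
  have f2 := two_mul_form hβ α
  rw [form_comm] at f2
  have p1 := form_self_pos hα
  have p2 := form_self_pos hβ
  have hexp : S.form (β - (1 : ℝ) • α) (β - (1 : ℝ) • α) =
      S.form β β - 2 * S.form β α + S.form α α := by
    rw [form_sub_smul, form_comm β, form_comm α, form_sub_smul, form_sub_smul, form_comm α β]
    ring
  have hnn : ∀ γ ∈ S.R, 0 ≤ S.coroot γ (β - (1 : ℝ) • α) * S.coroot γ (β - (1 : ℝ) • α) :=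
    fun _ _ => mul_self_nonneg _
  have hz0 : S.form (β - (1 : ℝ) • α) (β - (1 : ℝ) • α) = 0 :=
    le_antisymm (by rw [hexp]; nlinarith) (Finset.sum_nonneg hnn)
  have hz : ∀ γ ∈ S.R, S.coroot γ (β - α) = 0 := by
    intro γ hγ
    have := (Finset.sum_eq_zero_iff_of_nonneg hnn).1 hz0 γ hγ
    simpa using this
  by_contra hne
  have hmem : ∀ n : ℕ, α + (2 * n : ℝ) • (β - α) ∈ S.R := by
    intro n
    induction n with
    | zero => simpa using hα
    | succ n ih =>
      have := refl_mem_R hβ (refl_mem_R hα ih)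
      convert this using 1
      have e1 : S.coroot β α = 2 := by
        have := hz β hβ
        rw [map_sub, S.coroot_self β hβ] at this
        linarith
      rw [refl_apply hα, refl_apply hβ]
      simp only [map_add, map_sub (S.coroot β) (α + _), map_smul, hz α hα, hz β hβ, e1,
        S.coroot_self α hα, smul_eq_mul]
      push_cast
      module
  refine Set.infinite_of_injective_forall_mem (s := (S.R : Set V))
    (f := fun n : ℕ => α + (2 * n : ℝ) • (β - α)) ?_ hmem S.R.finite_toSet
  intro m n hmn
  have := smul_left_injective ℝ (sub_ne_zero.2 (Ne.symm hne)) (add_left_cancel hmn)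
  have h' : (2 * m : ℝ) = 2 * n := this
  exact_mod_cast (mul_left_cancel₀ two_ne_zero h')

lemma coroot_eq_one_or {α β : V} (hα : α ∈ S.R) (hβ : β ∈ S.R) (hne : α ≠ β)
    (h : 0 < S.coroot α β) : S.coroot α β = 1 ∨ S.coroot β α = 1 := by
  have h' := coroot_pos_symm hα hβ h
  obtain ⟨m, hm⟩ := S.crystallographic α hα β hβ
  obtain ⟨n, hn⟩ := S.crystallographic β hβ α hα
  by_contra! hc
  refine hne (eq_of_two_le_coroot hα hβ ?_ ?_)
  all_goals
    simp only [hm, hn] at h h' hc ⊢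
    norm_cast at h h' hc ⊢
    omega

/-- If `⟨β, α∨⟩ > 0` then `α∨ - β∨` is the coroot of a root that is a combination of `α`
and `β` with positive coefficient at `α`. -/
lemma exists_coroot_sub {α β : V} (hα : α ∈ S.R) (hβ : β ∈ S.R) (hne : α ≠ β)
    (h : 0 < S.coroot α β) :
    ∃ γ ∈ S.R, (∀ x, S.coroot γ x = S.coroot α x - S.coroot β x) ∧
      ∃ a b : ℝ, 0 < a ∧ γ = a • α - b • β := by
  rcases coroot_eq_one_or hα hβ hne h with h1 | h1
  · refine ⟨S.refl β α, refl_mem_R hβ hα, fun x => ?_, 1, S.coroot β α, one_pos, ?_⟩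
    · rw [coroot_refl hβ hα, h1, one_mul]
    · rw [refl_apply hβ, one_smul]
  · refine ⟨-S.refl α β, S.neg_mem _ (refl_mem_R hα hβ), fun x => ?_, S.coroot α β, 1, h, ?_⟩
    · rw [S.coroot_neg _ (refl_mem_R hα hβ), LinearMap.neg_apply, coroot_refl hα hβ, h1]
      ring
    · rw [refl_apply hα]
      module

/-! ### Positivity -/

lemma pos_of_comb {α β γ : V} {a b : ℝ} (hγ : γ ∈ S.R) (hα : α ∈ S.Rpos) (hβ : β ∈ S.Δ)
    (hne : α ≠ β) (ha : 0 < a) (h : γ = a • α - b • β) : γ ∈ S.Rpos := by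
  rcases S.pos_or_neg γ hγ with hp | hn
  · exact hp
  exfalso
  obtain ⟨c, hc⟩ := S.pos_sum_simple _ hn
  obtain ⟨d, hd⟩ := S.pos_sum_simple _ hα
  have hli : LinearIndepOn ℝ (fun x : V => x) (S.Δ : Set V) := S.simple_indep
  rw [linearIndepOn_finset_iff] at hli
  have hsum : ∑ x ∈ S.Δ, (a * d x + c x - if x = β then b else 0) • x = 0 := by
    simp only [sub_smul, add_smul, Finset.sum_sub_distrib, Finset.sum_add_distrib, mul_smul,
      ← Finset.smul_sum, ← hc, ← hd, ite_smul, zero_smul, Finset.sum_ite_eq', hβ, if_true, h]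
    module
  have hz := hli _ hsum
  have hd0 : ∀ x ∈ S.Δ, x ≠ β → (d x : ℝ) = 0 := by
    intro x hx hxb
    have := hz x hx
    rw [if_neg hxb, sub_zero] at this
    have h1 : (0 : ℝ) ≤ c x := Nat.cast_nonneg _
    have h2 : (0 : ℝ) ≤ d x := Nat.cast_nonneg _
    nlinarith
  have hαb : α = (d β : ℝ) • β := by
    rw [hd]
    refine Finset.sum_eq_single_of_mem β hβ fun x hx hxb => ?_
    rw [hd0 x hx hxb, zero_smul]
  have hmem : (d β : ℝ) • β ∈ S.R := hαb ▸ mem_R_of_pos hα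
  rcases S.reduced β (mem_R_of_simple hβ) _ hmem with h1 | h1
  · exact hne (by rw [hαb, h1, one_smul])
  · have : (0 : ℝ) ≤ d β := Nat.cast_nonneg _
    linarith

lemma refl_simple_pos {α β : V} (hα : α ∈ S.Rpos) (hβ : β ∈ S.Δ) (hne : α ≠ β) :
    S.refl β α ∈ S.Rpos :=
  pos_of_comb (refl_mem_R (mem_R_of_simple hβ) (mem_R_of_pos hα)) hα hβ hne one_pos
    (b := S.coroot β α) (by rw [refl_apply (mem_R_of_simple hβ), one_smul])

lemma map_nonneg_of_simple (f : V →ₗ[ℝ] ℝ) (hf : ∀ β ∈ S.Δ, 0 ≤ f β) {α : V}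
    (hα : α ∈ S.Rpos) : 0 ≤ f α := by
  obtain ⟨c, hc⟩ := S.pos_sum_simple α hα
  rw [hc, map_sum]
  refine Finset.sum_nonneg fun β hβ => ?_
  rw [map_smul, smul_eq_mul]
  exact mul_nonneg (Nat.cast_nonneg _) (hf β hβ)

lemma exists_simple_coroot_pos {α : V} (hα : α ∈ S.Rpos) : ∃ β ∈ S.Δ, 0 < S.coroot α β := by
  by_contra! hc
  have := map_nonneg_of_simple (-S.coroot α) (fun β hβ => by simpa using hc β hβ) hα
  rw [LinearMap.neg_apply, S.coroot_self α (mem_R_of_pos hα)] at this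
  norm_num at this

lemma pos_of_coroot_pos {μ : V} (hμ : ∀ α ∈ S.Rpos, 0 < S.coroot α μ) {α : V} (hα : α ∈ S.R)
    (h : 0 < S.coroot α μ) : α ∈ S.Rpos := by
  rcases S.pos_or_neg α hα with hp | hn
  · exact hp
  · have := hμ _ hn
    rw [S.coroot_neg α hα, LinearMap.neg_apply] at this
    linarith

/-! ### Words in simple reflections -/

lemma word_cons (b : V) (L : List V) : S.word (b :: L) = S.refl b * S.word L := by
  simp [word]

lemma word_append (L M : List V) : S.word (L ++ M) = S.word L * S.word M := by
  simp [word]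

lemma word_mem_weyl {L : List V} (hL : ∀ b ∈ L, b ∈ S.Δ) : S.word L ∈ S.Weyl := by
  refine list_prod_mem fun g hg => ?_
  obtain ⟨b, hb, rfl⟩ := List.mem_map.1 hg
  exact refl_mem_weyl (mem_R_of_simple (hL b hb))

lemma word_reverse {L : List V} (hL : ∀ b ∈ L, b ∈ S.Δ) : S.word L.reverse = (S.word L)⁻¹ := by
  induction L with
  | nil => simp [word]
  | cons b L ih =>
    rw [List.reverse_cons, word_append, ih fun x hx => hL x (List.mem_cons_of_mem _ hx),
      word_cons b L, mul_inv_rev, refl_inv (mem_R_of_simple (hL b List.mem_cons_self))]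
    simp [word]

lemma mul_refl_of_mem_rootAut {g : V ≃ₗ[ℝ] V} (hg : g ∈ S.rootAut) {α : V} (hα : α ∈ S.R) :
    g * S.refl α = S.refl (g α) * g := by
  ext x
  simp only [LinearEquiv.mul_apply, refl_apply hα, refl_apply (hg α hα).1, (hg α hα).2,
    map_sub, map_smul]

lemma exists_word_simple_eq {μ : V} (hμ : ∀ α ∈ S.Rpos, 0 < S.coroot α μ) {α : V}
    (hα : α ∈ S.Rpos) : ∃ L : List V, (∀ b ∈ L, b ∈ S.Δ) ∧ ∃ b ∈ S.Δ, S.word L b = α := by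
  by_contra hc
  let bad := S.Rpos.filter fun α =>
    ¬ ∃ L : List V, (∀ b ∈ L, b ∈ S.Δ) ∧ ∃ b ∈ S.Δ, S.word L b = α
  obtain ⟨β, hβ, hmin⟩ := bad.exists_min_image (fun α => S.coroot α μ)
    ⟨α, Finset.mem_filter.2 ⟨hα, hc⟩⟩
  obtain ⟨hβp, hβbad⟩ := Finset.mem_filter.1 hβ
  obtain ⟨b, hb, hpos⟩ := exists_simple_coroot_pos hβp
  have hbR := mem_R_of_simple hb
  have hne : β ≠ b := fun h => hβbad ⟨[], by simp, b, hb, by simp [word, h]⟩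
  have hnb : S.refl b β ∉ bad := by
    intro hmem
    have h1 := hmin _ hmem
    rw [coroot_refl hbR (mem_R_of_pos hβp)] at h1
    have := mul_pos hpos (hμ b (pos_of_simple hb))
    linarith
  have hgood := hnb ∘ fun h => Finset.mem_filter.2 ⟨refl_simple_pos hβp hb hne, h⟩
  obtain ⟨L, hL, a, ha, h⟩ := not_not.1 hgood
  refine hβbad ⟨b :: L, ?_, a, ha, ?_⟩
  · intro x hx
    rcases List.mem_cons.1 hx with rfl | hx
    exacts [hb, hL x hx]
  · rw [word_cons, LinearEquiv.mul_apply, h, refl_refl hbR]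

lemma refl_neg {α : V} (hα : α ∈ S.R) : S.refl (-α) = S.refl α := by
  ext x
  rw [refl_apply hα, refl_apply (S.neg_mem α hα), S.coroot_neg α hα]
  simp

lemma exists_word_eq_refl {μ : V} (hμ : ∀ α ∈ S.Rpos, 0 < S.coroot α μ) {α : V}
    (hα : α ∈ S.Rpos) : ∃ L : List V, (∀ b ∈ L, b ∈ S.Δ) ∧ S.word L = S.refl α := by
  obtain ⟨L, hL, b, hb, rfl⟩ := exists_word_simple_eq hμ hα
  refine ⟨L ++ b :: L.reverse, ?_, ?_⟩
  · intro x hx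
    simp only [List.mem_append, List.mem_cons, List.mem_reverse] at hx
    rcases hx with h | rfl | h
    exacts [hL x h, hb, hL x h]
  · rw [word_append, word_cons, word_reverse hL, ← mul_assoc,
      mul_refl_of_mem_rootAut (weyl_le_rootAut (word_mem_weyl hL)) (mem_R_of_simple hb),
      mul_inv_cancel_right]

lemma exists_word_eq {μ : V} (hμ : ∀ α ∈ S.Rpos, 0 < S.coroot α μ) {g : V ≃ₗ[ℝ] V}
    (hg : g ∈ S.Weyl) : ∃ L : List V, (∀ b ∈ L, b ∈ S.Δ) ∧ S.word L = g := by
  induction hg using Subgroup.closure_induction with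
  | mem x hx =>
    obtain ⟨α, hα, h⟩ := hx
    rw [eq_refl_of_apply hα h]
    rcases S.pos_or_neg α hα with hp | hn
    · exact exists_word_eq_refl hμ hp
    · rw [← refl_neg hα]
      exact exists_word_eq_refl hμ hn
  | one => exact ⟨[], by simp, by simp [word]⟩
  | mul x y _ _ hx hy =>
    obtain ⟨L, hL, rfl⟩ := hx
    obtain ⟨M, hM, rfl⟩ := hy
    refine ⟨L ++ M, fun b hb => ?_, word_append L M⟩
    rcases List.mem_append.1 hb with h | h
    exacts [hL b h, hM b h]
  | inv x _ hx =>
    obtain ⟨L, hL, rfl⟩ := hx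
    exact ⟨L.reverse, fun b hb => hL b (List.mem_reverse.1 hb), word_reverse hL⟩

/-- The exchange condition. -/
lemma exists_shorter_word {a : V} (ha : a ∈ S.Δ) (L : List V) (hL : ∀ b ∈ L, b ∈ S.Δ)
    (h : S.word L a ∉ S.Rpos) :
    ∃ L' : List V, (∀ b ∈ L', b ∈ S.Δ) ∧ L'.length < L.length ∧
      S.word L' = S.word L * S.refl a := by
  induction L with
  | nil => exact absurd (pos_of_simple ha) (by simpa [word] using h)
  | cons b L ih =>
    have hb := hL b List.mem_cons_self
    have hL1 : ∀ x ∈ L, x ∈ S.Δ := fun x hx => hL x (List.mem_cons_of_mem _ hx)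
    by_cases hpos : S.word L a ∈ S.Rpos
    · have heq : S.word L a = b := by
        by_contra hne
        rw [word_cons, LinearEquiv.mul_apply] at h
        exact h (refl_simple_pos hpos hb hne)
      refine ⟨L, hL1, by simp, ?_⟩
      rw [word_cons, mul_assoc,
        mul_refl_of_mem_rootAut (weyl_le_rootAut (word_mem_weyl hL1)) (mem_R_of_simple ha), heq,
        ← mul_assoc, refl_mul_self (mem_R_of_simple hb), one_mul]
    · obtain ⟨L', hL', hlen, hw⟩ := ih hL1 hpos
      refine ⟨b :: L', ?_, by simpa using hlen, ?_⟩
      · intro x hx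
        rcases List.mem_cons.1 hx with rfl | hx
        exacts [hb, hL' x hx]
      · rw [word_cons, hw, word_cons, mul_assoc]

/-- A Weyl group element preserving the positive roots is trivial. -/
lemma eq_one_of_map_pos {μ : V} (hμ : ∀ α ∈ S.Rpos, 0 < S.coroot α μ) {g : V ≃ₗ[ℝ] V}
    (hg : g ∈ S.Weyl) (hpos : ∀ α ∈ S.Rpos, g α ∈ S.Rpos) : g = 1 := by
  have hex : ∃ n, ∃ L : List V, (∀ b ∈ L, b ∈ S.Δ) ∧ S.word L = g ∧ L.length = n := by
    obtain ⟨L, hL, h⟩ := exists_word_eq hμ hg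
    exact ⟨_, L, hL, h, rfl⟩
  obtain ⟨L, hL, hLg, hlen⟩ := Nat.find_spec hex
  rcases List.eq_nil_or_concat' L with rfl | ⟨M, a, rfl⟩
  · rw [← hLg]
    simp [word]
  exfalso
  have ha : a ∈ S.Δ := hL a (by simp)
  have hM : ∀ b ∈ M, b ∈ S.Δ := fun b hb => hL b (by simp [hb])
  have hgM : S.word M * S.refl a = g := by
    rw [← hLg, word_append]
    simp [word]
  have hMa : S.word M a = - g a := by
    rw [← hgM, LinearEquiv.mul_apply, refl_self (mem_R_of_simple ha), map_neg, neg_neg]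
  have hneg : S.word M a ∉ S.Rpos := by
    intro hp
    have := S.pos_not_neg _ (hpos a (pos_of_simple ha))
    rw [hMa] at hp
    exact this hp
  obtain ⟨L', hL', hlt, hw⟩ := exists_shorter_word ha M hM hneg
  refine Nat.find_min hex ?_ ⟨L', hL', hw.trans hgM, rfl⟩
  rw [← hlen, List.length_append]
  omega

/-! ### Highest coroots -/

lemma IsHighestCoroot.coroot_nonneg {i α : V} (hi : S.IsHighestCoroot i) (hα : α ∈ S.Rpos) :
    0 ≤ S.coroot i α :=
  map_nonneg_of_simple _ hi.2.1 hα

lemma IsHighestCoroot.nonneg_coroot {i α : V} (hi : S.IsHighestCoroot i) (hα : α ∈ S.Rpos) :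
    0 ≤ S.coroot α i :=
  coroot_nonneg_symm hi.1 (mem_R_of_pos hα) (hi.coroot_nonneg hα)

lemma IsHighestCoroot.pos {i : V} (hi : S.IsHighestCoroot i) : i ∈ S.Rpos := by
  rcases S.pos_or_neg i hi.1 with hp | hn
  · exact hp
  · have := hi.coroot_nonneg hn
    rw [map_neg, S.coroot_self i hi.1] at this
    norm_num at this

/-- No positive coroot can be added to a highest coroot. -/
lemma IsHighestCoroot.coroot_ne_add {μ : V} (hμ : ∀ α ∈ S.Rpos, 0 < S.coroot α μ) {i : V}
    (hi : S.IsHighestCoroot i) {δ σ : V} (hδ : δ ∈ S.Rpos) (hσ : σ ∈ S.R) :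
    S.coroot σ ≠ S.coroot i + S.coroot δ := by
  intro h
  let cand := S.Rpos.filter fun δ => ∃ σ ∈ S.R, S.coroot σ = S.coroot i + S.coroot δ
  obtain ⟨δ₀, hδ₀, hmin⟩ := cand.exists_min_image (fun α => S.coroot α μ)
    ⟨δ, Finset.mem_filter.2 ⟨hδ, σ, hσ, h⟩⟩
  obtain ⟨hp, τ, hτ, hsum⟩ := Finset.mem_filter.1 hδ₀
  obtain ⟨b, hb, hbpos⟩ := exists_simple_coroot_pos hp
  have hbR := mem_R_of_simple hb
  by_cases hne : δ₀ = b
  · exact hi.2.2 b hb τ hτ (by rw [hsum, hne])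
  obtain ⟨γ, hγ, hγc, x, y, hx, hxy⟩ := exists_coroot_sub (mem_R_of_pos hp) hbR hne hbpos
  have hγp := pos_of_comb hγ hp hb hne hx hxy
  have hτb : τ ≠ b := by
    rintro rfl
    have h1 := hμ γ hγp
    have h2 := hμ i hi.pos
    rw [hγc, hsum, LinearMap.add_apply] at h1
    linarith
  have hτpos : 0 < S.coroot τ b := by
    rw [hsum, LinearMap.add_apply]
    have := hi.2.1 b hb
    linarith
  obtain ⟨ε, hε, hεc, -⟩ := exists_coroot_sub hτ hbR hτb hτpos
  have hcand : γ ∈ cand := by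
    refine Finset.mem_filter.2 ⟨hγp, ε, hε, LinearMap.ext fun z => ?_⟩
    rw [hεc, LinearMap.add_apply, hγc, hsum, LinearMap.add_apply]
    ring
  have h1 := hmin γ hcand
  rw [hγc] at h1
  have := hμ b (pos_of_simple hb)
  linarith

/-- If `⟨β, i∨⟩ > 0` with `i∨` highest, then `i∨ - β∨` is a positive coroot or zero. -/
lemma IsHighestCoroot.exists_pos_coroot_sub {μ : V} (hμ : ∀ α ∈ S.Rpos, 0 < S.coroot α μ)
    {i : V} (hi : S.IsHighestCoroot i) {β : V} (hβ : β ∈ S.R) (hne : i ≠ β)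
    (h : 0 < S.coroot i β) :
    ∃ γ ∈ S.Rpos, ∀ x, S.coroot γ x = S.coroot i x - S.coroot β x := by
  obtain ⟨γ, hγ, hγc, -⟩ := exists_coroot_sub hi.1 hβ hne h
  rcases S.pos_or_neg γ hγ with hp | hn
  · exact ⟨γ, hp, hγc⟩
  · refine absurd (LinearMap.ext fun x => ?_) (hi.coroot_ne_add hμ hn hβ)
    rw [LinearMap.add_apply, S.coroot_neg γ hγ, LinearMap.neg_apply, hγc]
    ring

lemma IsHighestCoroot.orthogonal {μ : V} (hμ : ∀ α ∈ S.Rpos, 0 < S.coroot α μ) {i j : V}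
    (hi : S.IsHighestCoroot i) (hj : S.IsHighestCoroot j) (hne : i ≠ j) :
    S.coroot i j = 0 := by
  refine le_antisymm ?_ (hi.coroot_nonneg hj.pos)
  by_contra! hc
  obtain ⟨γ, hγ, hγc⟩ := hi.exists_pos_coroot_sub hμ hj.1 hne hc
  refine hj.coroot_ne_add hμ hγ hi.1 (LinearMap.ext fun x => ?_)
  rw [LinearMap.add_apply, hγc]
  ring

lemma IsHighestCoroot.eq_of_two_le {μ : V} (hμ : ∀ α ∈ S.Rpos, 0 < S.coroot α μ) {i : V}
    (hi : S.IsHighestCoroot i) {β : V} (hβ : β ∈ S.R) (h : 2 ≤ S.coroot β i) : i = β := by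
  by_contra hne
  have hpos : 0 < S.coroot i β := coroot_pos_symm hβ hi.1 (by linarith)
  obtain ⟨γ, hγ, hγc⟩ := hi.exists_pos_coroot_sub hμ hβ hne hpos
  have hγR := mem_R_of_pos hγ
  have h0 : S.coroot γ i = 0 := by
    refine le_antisymm ?_ (hi.nonneg_coroot hγ)
    rw [hγc, S.coroot_self i hi.1]
    linarith
  have h1 : S.coroot i γ = 0 := coroot_zero_symm hγR hi.1 h0
  refine hi.coroot_ne_add hμ hγ (refl_mem_R hγR hβ) (LinearMap.ext fun x => ?_)
  have h2 : S.coroot β γ = -2 := by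
    have := hγc γ
    rw [S.coroot_self γ hγR, h1] at this
    linarith
  rw [coroot_refl hγR hβ, h2, LinearMap.add_apply, hγc]
  ring

lemma IsHighestCoroot.eq_of_pos {μ : V} (hμ : ∀ α ∈ S.Rpos, 0 < S.coroot α μ) {i j : V}
    (hi : S.IsHighestCoroot i) (hj : S.IsHighestCoroot j) {β : V} (hβ : β ∈ S.R)
    (h1 : 0 < S.coroot β i) (h2 : 0 < S.coroot β j) : i = j := by
  by_contra hne
  have hij := hi.orthogonal hμ hj hne
  by_cases hb : i = β
  · rw [← hb, hij] at h2
    exact lt_irrefl _ h2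
  obtain ⟨γ, hγ, hγc⟩ := hi.exists_pos_coroot_sub hμ hβ hb (coroot_pos_symm hβ hi.1 h1)
  have := hj.nonneg_coroot hγ
  rw [hγc, hij] at this
  linarith

/-- A coroot pairing to at least `2` with a sum of distinct roots with highest coroots is the
coroot of one of the summands. -/
lemma mem_of_two_le_coroot_sum {μ : V} (hμ : ∀ α ∈ S.Rpos, 0 < S.coroot α μ) {T : Finset V}
    (hT : ∀ i ∈ T, S.IsHighestCoroot i) {β : V} (hβ : β ∈ S.R)
    (h : 2 ≤ S.coroot β (∑ i ∈ T, i)) : β ∈ T := by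
  rw [map_sum] at h
  obtain ⟨i, hi, hipos⟩ : ∃ i ∈ T, 0 < S.coroot β i := by
    by_contra! hc
    have := Finset.sum_nonpos hc
    linarith
  have hle : ∑ j ∈ T.erase i, S.coroot β j ≤ 0 := by
    refine Finset.sum_nonpos fun j hj => ?_
    obtain ⟨hji, hjT⟩ := Finset.mem_erase.1 hj
    by_contra! hc
    exact hji ((hT j hjT).eq_of_pos hμ (hT i hi) hβ hc hipos)
  rw [← Finset.add_sum_erase T _ hi] at h
  rw [← (hT i hi).eq_of_two_le hμ hβ (by linarith)]
  exact hi

/-- The product of the commuting reflections in pairwise orthogonal roots. -/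
lemma exists_weyl_apply_eq_sub_sum {T : Finset V} (hT : ∀ i ∈ T, i ∈ S.R)
    (horth : ∀ i ∈ T, ∀ j ∈ T, i ≠ j → S.coroot i j = 0) :
    ∃ v ∈ S.Weyl, ∀ x, v x = x - ∑ i ∈ T, S.coroot i x • i := by
  induction T using Finset.induction_on with
  | empty => exact ⟨1, one_mem _, by simp⟩
  | insert a T ha ih =>
    obtain ⟨v, hv, hvx⟩ := ih (fun i hi => hT i (Finset.mem_insert_of_mem hi))
      fun i hi j hj => horth i (Finset.mem_insert_of_mem hi) j (Finset.mem_insert_of_mem hj)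
    have haR := hT a (Finset.mem_insert_self a T)
    refine ⟨S.refl a * v, mul_mem (refl_mem_weyl haR) hv, fun x => ?_⟩
    have h0 : ∑ i ∈ T, S.coroot i x * S.coroot a i = 0 := by
      refine Finset.sum_eq_zero fun i hi => ?_
      rw [horth a (Finset.mem_insert_self a T) i (Finset.mem_insert_of_mem hi)
        (by rintro rfl; exact ha hi), mul_zero]
    rw [LinearEquiv.mul_apply, hvx, refl_apply haR, Finset.sum_insert ha, map_sub, map_sum]
    simp only [map_smul, smul_eq_mul, h0, sub_zero]
    abel

end Ctx

/-- Claims `nustable` and `sigma`: if moreover `ν = Σ_{i∈T} α_i` is a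
multiplicity-free sum of roots whose coroots are highest coroots, then `w(π(ν)) = ν` and
`u = Π_{i∈T} s_{α_i}` (a product of pairwise commuting — indeed mutually orthogonal —
reflections, given here by its pointwise formula). -/
theorem statement15 {V : Type} [AddCommGroup V] [Module ℝ V] [FiniteDimensional ℝ V]
    (S : Ctx V) (p : ℕ) (hp : p.Prime) (hηp : ∀ α ∈ S.R, S.coroot α S.eta < (p : ℝ))
    (π : V ≃ₗ[ℝ] V)
    (hπR : ∀ α ∈ S.R, π α ∈ S.R) (hπpos : ∀ α ∈ S.Rpos, π α ∈ S.Rpos)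
    (hπΔ : ∀ α ∈ S.Δ, π α ∈ S.Δ) (hπX : ∀ x ∈ S.X, π x ∈ S.X)
    (hπpair : ∀ α ∈ S.R, ∀ x : V, S.coroot (π α) (π x) = S.coroot α x)
    (hπη : π S.eta = S.eta)
    (hπord : ∃ m : ℕ, 0 < m ∧ π ^ m = 1)
    (μ lam : V) (hμX : μ ∈ S.X) (hlamX : lam ∈ S.X)
    (hμC : μ - S.eta ∈ S.C0 p) (hlamC : lam - S.eta ∈ S.C0 p)
    (hdiff : μ - lam ∈ S.rootLattice)
    (s w u : V ≃ₗ[ℝ] V) (hs : s ∈ S.Weyl) (hw : w ∈ S.Weyl) (hu : u ∈ S.Weyl)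
    (ν : V) (hν : ν ∈ S.X)
    (hconj : w = u * s * π * u⁻¹ * π⁻¹)
    (hlam : lam = u μ + (p : ℝ) • ν - w (π ν))
    (T : Finset V) (hTR : ∀ i ∈ T, i ∈ S.R)
    (hTh : ∀ i ∈ T, S.IsHighestCoroot i)
    (hνsum : ν = ∑ i ∈ T, i) :
    w (π ν) = ν ∧ (∀ i ∈ T, ∀ j ∈ T, i ≠ j → S.coroot i j = 0) ∧
      ∀ x : V, u x = x - ∑ i ∈ T, S.coroot i x • i := by
  have hμ : ∀ α ∈ S.Rpos, 0 < S.coroot α μ ∧ S.coroot α μ < p := fun α hα => by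
    simpa using hμC α hα
  have hL : ∀ α ∈ S.Rpos, 0 < S.coroot α lam ∧ S.coroot α lam < p := fun α hα => by
    simpa using hlamC α hα
  have hμ0 : ∀ α ∈ S.Rpos, 0 < S.coroot α μ := fun α hα => (hμ α hα).1
  have horth : ∀ i ∈ T, ∀ j ∈ T, i ≠ j → S.coroot i j = 0 := fun i hi j hj =>
    (hTh i hi).orthogonal hμ0 (hTh j hj)
  have huinv := Ctx.weyl_le_rootAut (inv_mem hu)
  have huu : ∀ x, u⁻¹ (u x) = x := fun x => u.symm_apply_apply x
  have hπA : π ∈ S.rootAut := fun α hα => ⟨hπR α hα, hπpair α hα⟩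
  have hgA : w * π ∈ S.rootAut := mul_mem (Ctx.weyl_le_rootAut hw) hπA
  have hginv := Ctx.inv_mem_rootAut hgA
  have hgg : ∀ x, (w * π)⁻¹ ((w * π) x) = x := fun x => (w * π).symm_apply_apply x
  have hνi : ∀ i ∈ T, S.coroot i ν = 2 := by
    intro i hi
    rw [hνsum, map_sum, Finset.sum_eq_single_of_mem i hi fun j hj hji =>
      horth i hi j hj (Ne.symm hji), S.coroot_self i (hTR i hi)]
  have hlt : ∀ α ∈ S.R, ∀ x ∈ S.X, ∀ m : ℤ, S.coroot α x < m → S.coroot α x ≤ m - 1 := by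
    intro α hα x hx m h
    obtain ⟨n, hn⟩ := S.coroot_int α hα x hx
    rw [hn] at h ⊢
    have : n < m := by exact_mod_cast h
    have : n ≤ m - 1 := by omega
    exact_mod_cast this
  have hμle : ∀ α ∈ S.R, S.coroot α μ ≤ p - 1 := by
    intro α hα
    refine mod_cast hlt α hα μ hμX p ?_
    rcases S.pos_or_neg α hα with h | h
    · exact_mod_cast (hμ α h).2
    · have h1 := hμ0 _ h
      rw [S.coroot_neg α hα, LinearMap.neg_apply] at h1
      have : (0 : ℝ) ≤ p := Nat.cast_nonneg p
      push_cast
      linarith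
  have hLle : ∀ α ∈ S.Rpos, S.coroot α lam ≤ p - 1 := fun α hα =>
    mod_cast hlt α (S.pos_subset hα) lam hlamX p (by exact_mod_cast (hL α hα).2)
  have hinvT : ∀ i ∈ T, (w * π)⁻¹ i ∈ T := by
    intro i hi
    have hiR := hTR i hi
    refine Ctx.mem_of_two_le_coroot_sum hμ0 hTh (hginv i hiR).1 ?_
    have e1 : S.coroot ((w * π)⁻¹ i) ν = S.coroot i (w (π ν)) := by
      rw [← (hginv i hiR).2 (w (π ν))]
      exact congrArg _ (hgg ν).symm
    have e2 : S.coroot (-(u⁻¹ i)) μ = - S.coroot i (u μ) := by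
      rw [S.coroot_neg _ (huinv i hiR).1, LinearMap.neg_apply, ← (huinv i hiR).2 (u μ), huu]
    have e3 := hμle _ (S.neg_mem _ (huinv i hiR).1)
    have e4 := hLle i (hTh i hi).pos
    rw [hlam, map_sub, map_add, map_smul, hνi i hi, smul_eq_mul] at e4
    rw [← hνsum, e1]
    linarith
  have hwν : w (π ν) = ν := by
    have hinj : Set.InjOn (fun i => (w * π)⁻¹ i) (T : Set V) := fun a _ b _ h =>
      (w * π)⁻¹.injective h
    have himg : T.image (fun i => (w * π)⁻¹ i) = T :=
      Finset.eq_of_subset_of_card_le (Finset.image_subset_iff.2 hinvT)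
        (Finset.card_image_of_injOn hinj).ge
    have hfix : (w * π)⁻¹ ν = ν := by
      rw [hνsum, map_sum]
      conv_rhs => rw [← himg]
      exact (Finset.sum_image (f := fun i : V => i) hinj).symm
    calc w (π ν) = (w * π) ((w * π)⁻¹ ν) := by rw [hfix]; rfl
      _ = ν := (w * π).apply_symm_apply ν
  refine ⟨hwν, horth, ?_⟩
  obtain ⟨v, hv, hvx⟩ := Ctx.exists_weyl_apply_eq_sub_sum hTR horth
  have hvA := Ctx.weyl_le_rootAut hv
  have hνnonneg : ∀ α ∈ S.Rpos, ∀ i ∈ T, 0 ≤ S.coroot α i := fun α hα i hi =>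
    (hTh i hi).nonneg_coroot hα
  have hvν : v ν = -ν := by
    have : ∑ i ∈ T, S.coroot i ν • i = (2 : ℝ) • ν := by
      conv_rhs => rw [hνsum, Finset.smul_sum]
      exact Finset.sum_congr rfl fun i hi => by rw [hνi i hi]
    rw [hvx, this]
    module
  have hlam' : ∀ α, S.coroot α (u μ) = S.coroot α lam - (p - 1) * S.coroot α ν := by
    intro α
    rw [hlam, hwν, map_sub, map_add, map_smul, smul_eq_mul]
    ring
  have hp1 : (1 : ℝ) ≤ p := by exact_mod_cast hp.one_lt.le
  have huμ : ∀ α ∈ S.R, S.coroot (u⁻¹ α) μ = S.coroot α (u μ) := by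
    intro α hα
    rw [← (huinv α hα).2 (u μ), huu]
  have hnegν : ∀ α ∈ S.Rpos, 0 < S.coroot α ν → S.coroot α (u μ) < 0 := by
    intro α hα h
    have hαR := S.pos_subset hα
    obtain ⟨n, hn⟩ := S.coroot_int α hαR ν hν
    have hn1 : (1 : ℝ) ≤ n := by
      rw [hn] at h
      have : 0 < n := by exact_mod_cast h
      exact_mod_cast this
    have h1 : S.coroot α (u μ) ≤ 0 := by
      rw [hlam', hn]
      have := hLle α hα
      nlinarith
    refine lt_of_le_of_ne h1 fun h0 => ?_
    rw [← huμ α hαR] at h0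
    rcases S.pos_or_neg _ (huinv α hαR).1 with hq | hq
    · exact (hμ0 _ hq).ne' h0
    · have := hμ0 _ hq
      rw [S.coroot_neg _ (huinv α hαR).1, LinearMap.neg_apply, h0] at this
      simp at this
  have hg : u⁻¹ * v = 1 := by
    refine Ctx.eq_one_of_map_pos hμ0 (mul_mem (inv_mem hu) hv) fun α hα => ?_
    have hαR := S.pos_subset hα
    have hvα := (hvA α hαR).1
    refine Ctx.pos_of_coroot_pos hμ0 (huinv _ hvα).1 ?_
    rw [LinearEquiv.mul_apply, huμ _ hvα]
    have hsum : S.coroot α ν = ∑ i ∈ T, S.coroot α i := by rw [hνsum, map_sum]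
    have hnn : 0 ≤ S.coroot α ν := hsum ▸ Finset.sum_nonneg (hνnonneg α hα)
    rcases hnn.eq_or_lt with h0 | h0
    · have hz := (Finset.sum_eq_zero_iff_of_nonneg (hνnonneg α hα)).1 (hsum.symm.trans h0.symm)
      have hfix : v α = α := by
        rw [hvx, Finset.sum_eq_zero, sub_zero]
        intro i hi
        rw [Ctx.coroot_zero_symm hαR (hTR i hi) (hz i hi), zero_smul]
      rw [hfix, hlam', ← h0]
      simpa using (hL α hα).1
    · have hvαν : S.coroot (v α) ν = - S.coroot α ν := by
        rw [← (hvA α hαR).2 ν, hvν, map_neg, neg_neg]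
      rcases S.pos_or_neg _ hvα with hq | hq
      · have : 0 ≤ S.coroot (v α) ν := by
          rw [hνsum, map_sum]
          exact Finset.sum_nonneg (hνnonneg _ hq)
        linarith
      · have := hnegν _ hq (by rw [S.coroot_neg _ hvα, LinearMap.neg_apply]; linarith)
        rw [S.coroot_neg _ hvα, LinearMap.neg_apply] at this
        linarith
  have huv : u = v := (inv_mul_eq_one.1 hg)
  intro x
  rw [huv, hvx]

end SerrePaper
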